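/- arXiv:2104.09706 — 2 statements merged into one kernel-verified Lean document; each statement's English description precedes it below -/
import Mathlib

section
/- Let G be a walk-regular graph with at least 3 vertices, and let ab be an edge that is not a cut-edge. Let G' = G minus the edge ab. Then the expected hitting time from a to b for simple random walk on G' satisfies E_a T_b^{G'} = (|E| - 1) R_{ab} / (1 - R_{ab}) = (E_a T_b - R_{ab})/(1 - R_{ab}), where |E| is the number of edges of G and R_{ab} is the effective resistance between a and b in G (unit resistances). -/
open Finset

section Defs

variable {V : Type*} [Fintype V]

/-- Total conductance at a vertex. -/
noncomputable def condAt (c : V → V → ℝ) (x : V) : ℝ := ∑ y, c x y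

/-- Transition probabilities of the random walk induced by conductances `c`. -/
noncomputable def step (c : V → V → ℝ) (x y : V) : ℝ := c x y / condAt c x

open scoped Classical in
/-- `surv P b n a` is the probability that the walk with transition matrix `P`
started at `a` has not visited `b` by time `n`. -/
noncomputable def surv (P : V → V → ℝ) (b : V) : ℕ → V → ℝ
  | 0 => fun a => if a = b then 0 else 1
  | n + 1 => fun a => if a = b then 0 else ∑ y, P a y * surv P b n y

/-- Expected hitting time of `b` starting from `a`, as the sum over `n` of the
survival probabilities `P(T_b > n)`. -/
noncomputable def hitTime (P : V → V → ℝ) (a b : V) : ℝ := ∑' n, surv P b n a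

/-- Expected return time to `z` : one step plus the expected hitting time of `z`
from the position after the first step. -/
noncomputable def returnTime (P : V → V → ℝ) (z : V) : ℝ :=
  1 + ∑ y, P z y * hitTime P y z

/-- Dirichlet energy of a potential `f` for conductances `c`. -/
noncomputable def energy (c : V → V → ℝ) (f : V → ℝ) : ℝ :=
  (1 / 2) * ∑ x, ∑ y, c x y * (f x - f y) ^ 2

/-- Effective resistance between `a` and `b` (Dirichlet principle): the
reciprocal of the minimal Dirichlet energy among potentials with
`f a = 1`, `f b = 0`. -/
noncomputable def effRes (c : V → V → ℝ) (a b : V) : ℝ :=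
  1 / sInf {E : ℝ | ∃ f : V → ℝ, f a = 1 ∧ f b = 0 ∧ E = energy c f}

end Defs

open scoped Classical in
/-- Unit conductances on the edges of a simple graph. -/
noncomputable def gw {V : Type*} (G : SimpleGraph V) (x y : V) : ℝ :=
  if G.Adj x y then 1 else 0

/-- Number of edges of a simple graph. -/
noncomputable def numEdges {V : Type*} (G : SimpleGraph V) : ℕ := G.edgeSet.ncard

section Helpers

set_option linter.unusedSectionVars false

variable {V : Type*} [Fintype V] [DecidableEq V]

/-- The Laplacian as a linear map. -/
noncomputable def lapl (c : V → V → ℝ) : (V → ℝ) →ₗ[ℝ] (V → ℝ) where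
  toFun f x := ∑ y, c x y * (f x - f y)
  map_add' f g := by
    funext x
    simp only [Pi.add_apply, ← Finset.sum_add_distrib]
    exact Finset.sum_congr rfl fun y _ => by ring
  map_smul' r f := by
    funext x
    simp only [Pi.smul_apply, smul_eq_mul, RingHom.id_apply, Finset.mul_sum]
    exact Finset.sum_congr rfl fun y _ => by ring

lemma lapl_apply (c : V → V → ℝ) (f : V → ℝ) (x : V) :
    lapl c f x = ∑ y, c x y * (f x - f y) := rfl

lemma lapl_green (c : V → V → ℝ) (hs : ∀ x y, c x y = c y x) (f g : V → ℝ) :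
    ∑ x, g x * lapl c f x = (1 / 2) * ∑ x, ∑ y, c x y * ((f x - f y) * (g x - g y)) := by
  have h1 : ∑ x, g x * lapl c f x = ∑ x, ∑ y, c x y * ((f x - f y) * g x) := by
    refine Finset.sum_congr rfl fun x _ => ?_
    rw [lapl_apply, Finset.mul_sum]
    exact Finset.sum_congr rfl fun y _ => by ring
  have h2 : ∑ x, g x * lapl c f x = ∑ x, ∑ y, c x y * ((f y - f x) * g y) := by
    rw [h1, Finset.sum_comm]
    refine Finset.sum_congr rfl fun x _ => Finset.sum_congr rfl fun y _ => ?_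
    rw [hs y x]
  have h3 : ∑ x, ∑ y, c x y * ((f x - f y) * (g x - g y))
      = ∑ x, ∑ y, c x y * ((f x - f y) * g x) + ∑ x, ∑ y, c x y * ((f y - f x) * g y) := by
    simp only [← Finset.sum_add_distrib]
    exact Finset.sum_congr rfl fun x _ => Finset.sum_congr rfl fun y _ => by ring
  rw [h3, ← h1, ← h2]; ring

lemma lapl_sum (c : V → V → ℝ) (hs : ∀ x y, c x y = c y x) (f : V → ℝ) :
    ∑ x, lapl c f x = 0 := by
  have := lapl_green c hs f (fun _ => 1)
  simpa using this

lemma energy_eq (c : V → V → ℝ) (hs : ∀ x y, c x y = c y x) (f : V → ℝ) :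
    energy c f = ∑ x, f x * lapl c f x := by
  rw [lapl_green c hs, energy]
  simp only [sq]

lemma energy_nonneg (c : V → V → ℝ) (h0 : ∀ x y, 0 ≤ c x y) (f : V → ℝ) :
    0 ≤ energy c f := by
  unfold energy
  refine mul_nonneg (by norm_num) (Finset.sum_nonneg fun x _ => Finset.sum_nonneg fun y _ =>
    mul_nonneg (h0 x y) (sq_nonneg _))

lemma energy_zero (c : V → V → ℝ) (h0 : ∀ x y, 0 ≤ c x y) (f : V → ℝ) (h : energy c f = 0)
    (x y : V) (hc : 0 < c x y) : f x = f y := by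
  unfold energy at h
  have h1 : ∑ x, ∑ y, c x y * (f x - f y) ^ 2 = 0 := by linarith
  have h2 := (Finset.sum_eq_zero_iff_of_nonneg (fun x _ => Finset.sum_nonneg fun y _ =>
    mul_nonneg (h0 x y) (sq_nonneg (f x - f y)))).1 h1 x (Finset.mem_univ _)
  have h3 := (Finset.sum_eq_zero_iff_of_nonneg (fun y _ =>
    mul_nonneg (h0 x y) (sq_nonneg (f x - f y)))).1 h2 y (Finset.mem_univ _)
  have h4 : (f x - f y) ^ 2 = 0 := by
    rcases mul_eq_zero.1 h3 with h | h
    · exact absurd h hc.ne'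
    · exact h
  have := pow_eq_zero_iff (two_ne_zero) |>.1 h4
  linarith

/-- The network is connected: zero energy functions are constant. -/
def ConnNet (c : V → V → ℝ) : Prop :=
  (∀ x y, c x y = c y x) ∧ (∀ x y, 0 ≤ c x y) ∧
    (∀ f : V → ℝ, energy c f = 0 → ∀ x y, f x = f y)

lemma ConnNet.ker {c : V → V → ℝ} (hc : ConnNet c) (f : V → ℝ) (h : lapl c f = 0) (x y : V) :
    f x = f y := by
  refine hc.2.2 f ?_ x y
  rw [energy_eq c hc.1, h]; simp

lemma connNet_gw (G : SimpleGraph V) (hG : G.Connected) : ConnNet (gw G) := by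
  classical
  have h0 : ∀ x y, 0 ≤ gw G x y := by
    intro x y; unfold gw; split_ifs <;> norm_num
  refine ⟨fun x y => by simp [gw, G.adj_comm], h0, fun f hf x y => ?_⟩
  obtain ⟨w⟩ := hG.preconnected x y
  induction w with
  | nil => rfl
  | cons h _ ih =>
    rw [← ih]
    exact energy_zero _ h0 f hf _ _ (by simp [gw, h])

lemma ConnNet.condAt_pos {c : V → V → ℝ} (hc : ConnNet c) (hV : 3 ≤ Fintype.card V) (x : V) :
    0 < condAt c x := by
  have hnn : 0 ≤ condAt c x := Finset.sum_nonneg fun y _ => hc.2.1 x y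
  refine lt_of_le_of_ne hnn fun h => ?_
  have h1 : ∀ y, c x y = 0 := fun y =>
    (Finset.sum_eq_zero_iff_of_nonneg (fun y _ => hc.2.1 x y)).1 h.symm y (Finset.mem_univ _)
  have : Nontrivial V := Fintype.one_lt_card_iff_nontrivial.1 (by omega)
  obtain ⟨y, hy⟩ := exists_ne x
  have h2 := hc.ker (Pi.single x 1) (by
    funext z
    rw [lapl_apply]
    refine Finset.sum_eq_zero fun w _ => ?_
    by_cases hz : z = x
    · subst hz; simp [h1]
    · by_cases hw : w = x
      · subst hw; simp [hc.1 z w, h1]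
      · simp [hz, hw]) x y
  simp [hy] at h2

lemma ConnNet.solve {c : V → V → ℝ} (hc : ConnNet c) (b : V) (r : V → ℝ) (hr : ∑ x, r x = 0) :
    ∃ f : V → ℝ, lapl c f = r ∧ f b = 0 := by
  let T : (V → ℝ) →ₗ[ℝ] (V → ℝ) :=
    lapl c + (LinearMap.single ℝ (fun _ : V => ℝ) b).comp (LinearMap.proj b)
  have hT : ∀ f, T f = lapl c f + Pi.single b (f b) := fun f => rfl
  have hsum : ∀ f, ∑ x, T f x = f b := by
    intro f
    rw [hT]
    simp [Finset.sum_add_distrib, lapl_sum c hc.1]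
  have hinj : Function.Injective T := by
    rw [injective_iff_map_eq_zero]
    intro f hf
    have hb : f b = 0 := by rw [← hsum f, hf]; simp
    have : lapl c f = 0 := by
      have := hT f
      rw [hf, hb] at this
      simpa using this.symm
    funext x
    rw [hc.ker f this x b, hb]; rfl
  obtain ⟨f, hf⟩ := (LinearMap.injective_iff_surjective.1 hinj) r
  have hb : f b = 0 := by rw [← hsum f, hf, hr]
  refine ⟨f, ?_, hb⟩
  have := hT f
  rw [hf, hb] at this
  simpa using this.symm

lemma effRes_eq {c : V → V → ℝ} (hc : ConnNet c) {a b : V} (hab : a ≠ b) (v : V → ℝ)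
    (hv : lapl c v = Pi.single a 1 - Pi.single b 1) :
    effRes c a b = v a - v b := by
  have key : ∀ g : V → ℝ, ∑ x, g x * lapl c v x = g a - g b := by
    intro g
    rw [hv]
    simp [mul_sub, Finset.sum_sub_distrib, Pi.single_apply]
  have hE : energy c v = v a - v b := by rw [energy_eq c hc.1, key]
  set R := v a - v b with hR
  have hR0 : 0 < R := by
    refine lt_of_le_of_ne (hE ▸ energy_nonneg c hc.2.1 v) fun h => ?_
    have h1 := hc.2.2 v (by rw [hE, ← h])
    have h2 : lapl c v a = 0 := by
      rw [lapl_apply]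
      exact Finset.sum_eq_zero fun y _ => by rw [h1 a y]; ring
    rw [hv] at h2
    simp [hab] at h2
  -- energy expansion
  have hexp : ∀ f : V → ℝ, f a = 1 → f b = 0 →
      energy c f = 1 / R + energy c (fun x => f x - v x / R) := by
    intro f fa fb
    have h1 := key f
    rw [lapl_green c hc.1, fa, fb] at h1
    have h2 := hE
    unfold energy at h2
    have h3 : ∑ x, ∑ y, c x y * ((f x - v x / R) - (f y - v y / R)) ^ 2
        = ∑ x, ∑ y, c x y * (f x - f y) ^ 2
          - (2 / R) * ∑ x, ∑ y, c x y * ((v x - v y) * (f x - f y))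
          + (1 / R ^ 2) * ∑ x, ∑ y, c x y * (v x - v y) ^ 2 := by
      simp only [Finset.mul_sum, ← Finset.sum_add_distrib, ← Finset.sum_sub_distrib]
      refine Finset.sum_congr rfl fun x _ => Finset.sum_congr rfl fun y _ => ?_
      field_simp
      ring
    have h1' : ∑ x, ∑ y, c x y * ((v x - v y) * (f x - f y)) = 2 := by linarith
    have h2' : ∑ x, ∑ y, c x y * (v x - v y) ^ 2 = 2 * R := by linarith
    unfold energy
    rw [h3, h1', h2']
    field_simp
    ring
  have hleast : IsLeast {E : ℝ | ∃ f : V → ℝ, f a = 1 ∧ f b = 0 ∧ E = energy c f} (1 / R) := by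
    constructor
    · have fa : (v a - v b) / R = 1 := by rw [← hR]; field_simp
      refine ⟨fun x => (v x - v b) / R, fa, by simp, ?_⟩
      rw [hexp (fun x => (v x - v b) / R) fa (by simp)]
      have : energy c (fun x => (v x - v b) / R - v x / R) = 0 := by
        unfold energy
        have : ∀ x y, ((v x - v b) / R - v x / R - ((v y - v b) / R - v y / R)) = 0 := by
          intro x y; ring
        simp [this]
      rw [this, add_zero]
    · rintro E ⟨f, fa, fb, rfl⟩
      rw [hexp f fa fb]
      linarith [energy_nonneg c hc.2.1 (fun x => f x - v x / R)]
  unfold effRes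
  rw [hleast.csInf_eq]
  simp

lemma surv_nonneg {P : V → V → ℝ} (hP : ∀ x y, 0 ≤ P x y) (b : V) (n : ℕ) (x : V) :
    0 ≤ surv P b n x := by
  induction n generalizing x with
  | zero => unfold surv; split_ifs <;> norm_num
  | succ n ih =>
    unfold surv
    split_ifs
    · exact le_rfl
    · exact Finset.sum_nonneg fun y _ => mul_nonneg (hP x y) (ih y)

lemma surv_self (P : V → V → ℝ) (b : V) (n : ℕ) : surv P b n b = 0 := by
  cases n <;> simp [surv]

lemma surv_zero (P : V → V → ℝ) {b x : V} (h : x ≠ b) : surv P b 0 x = 1 := by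
  simp [surv, h]

lemma surv_succ (P : V → V → ℝ) {b x : V} (h : x ≠ b) (n : ℕ) :
    surv P b (n + 1) x = ∑ y, P x y * surv P b n y := by
  simp [surv, h]

lemma hitTime_self (P : V → V → ℝ) (b : V) : hitTime P b b = 0 := by
  simp [hitTime, surv_self]

/-- First step form of the Poisson equation. -/
lemma lapl_iff_step {c : V → V → ℝ} {x : V} (hx : 0 < condAt c x) (f : V → ℝ) :
    lapl c f x = condAt c x ↔ f x = 1 + ∑ y, step c x y * f y := by
  have h1 : lapl c f x = condAt c x * f x - ∑ y, c x y * f y := by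
    rw [lapl_apply, condAt, Finset.sum_mul, ← Finset.sum_sub_distrib]
    exact Finset.sum_congr rfl fun y _ => by ring
  have h2 : ∑ y, step c x y * f y = (∑ y, c x y * f y) / condAt c x := by
    rw [Finset.sum_div]
    exact Finset.sum_congr rfl fun y _ => by unfold step; ring
  rw [h1, h2]
  constructor
  · intro h
    field_simp
    linarith
  · intro h
    field_simp at h
    linarith

lemma lapl_hitTime {c : V → V → ℝ} (hc : ConnNet c) (hV : 3 ≤ Fintype.card V) (b : V) :
    lapl c (fun x => hitTime (step c) x b)
      = fun x => condAt c x - if x = b then ∑ z, condAt c z else 0 := by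
  have hpos := hc.condAt_pos hV
  have hP : ∀ x y, 0 ≤ step c x y := fun x y => div_nonneg (hc.2.1 x y) (hpos x).le
  have hP1 : ∀ x, ∑ y, step c x y = 1 := fun x => by
    unfold step
    rw [← Finset.sum_div]
    exact div_self (hpos x).ne'
  obtain ⟨h, hh, hb⟩ := hc.solve b
    (fun x => condAt c x - if x = b then ∑ z, condAt c z else 0) (by
      simp [Finset.sum_sub_distrib])
  have hstep : ∀ x, x ≠ b → h x = 1 + ∑ y, step c x y * h y := by
    intro x hx
    rw [← lapl_iff_step (hpos x), hh]
    simp [hx]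
  have hnn : ∀ x, 0 ≤ h x := by
    have : Nonempty V := ⟨b⟩
    obtain ⟨m, hm⟩ := Finite.exists_min h
    have : m = b := by
      by_contra hmb
      have h1 := hstep m hmb
      have h2 : ∑ y, step c m y * h m ≤ ∑ y, step c m y * h y :=
        Finset.sum_le_sum fun y _ => mul_le_mul_of_nonneg_left (hm y) (hP m y)
      rw [← Finset.sum_mul, hP1] at h2
      linarith
    intro x
    rw [← hb, ← this]; exact hm x
  have hpart : ∀ n x, ∑ i ∈ Finset.range n, surv (step c) b i x ≤ h x := by
    intro n
    induction n with
    | zero => intro x; simpa using hnn x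
    | succ n ih =>
      intro x
      by_cases hx : x = b
      · subst hx; simp [surv_self, hb]
      · rw [Finset.sum_range_succ', surv_zero _ hx, hstep x hx]
        simp only [surv_succ _ hx]
        rw [Finset.sum_comm, add_comm]
        simp only [← Finset.mul_sum]
        have := Finset.sum_le_sum (s := Finset.univ) fun y _ =>
          mul_le_mul_of_nonneg_left (ih y) (hP x y)
        linarith
  have hsm : ∀ x, Summable fun n => surv (step c) b n x := fun x =>
    summable_of_sum_range_le (fun n => surv_nonneg hP b n x) (fun n => hpart n x)
  have hoff : ∀ x, x ≠ b → lapl c (fun x => hitTime (step c) x b) x = condAt c x := by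
    intro x hx
    rw [lapl_iff_step (hpos x)]
    unfold hitTime
    rw [(hsm x).tsum_eq_zero_add, surv_zero _ hx]
    simp only [surv_succ _ hx]
    rw [Summable.tsum_finsetSum (fun y _ => (hsm y).mul_left _)]
    simp only [tsum_mul_left]
  have hsum := lapl_sum c hc.1 (fun x => hitTime (step c) x b)
  funext x
  by_cases hx : x = b
  · subst hx
    rw [← Finset.add_sum_erase _ _ (Finset.mem_univ x)] at hsum
    rw [Finset.sum_congr rfl (fun y hy => hoff y (Finset.ne_of_mem_erase hy))] at hsum
    have h2 := Finset.add_sum_erase Finset.univ (condAt c) (Finset.mem_univ x)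
    simp only [if_true]
    linarith
  · simp [hoff x hx, hx]

lemma walkReg_const_diag {A : Matrix V V ℝ} (hwr : ∀ (k : ℕ) (x y : V), (A ^ k) x x = (A ^ k) y y)
    (q : Polynomial ℝ) (x y : V) :
    (Polynomial.aeval A q) x x = (Polynomial.aeval A q) y y := by
  rw [Polynomial.aeval_eq_sum_range]
  simp only [Matrix.sum_apply, Matrix.smul_apply]
  exact Finset.sum_congr rfl fun i _ => by rw [hwr i x y]

lemma aeval_symm {A : Matrix V V ℝ} (hA : A.IsSymm)
    (q : Polynomial ℝ) (x y : V) :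
    (Polynomial.aeval A q) x y = (Polynomial.aeval A q) y x := by
  rw [Polynomial.aeval_eq_sum_range]
  simp only [Matrix.sum_apply, Matrix.smul_apply]
  exact Finset.sum_congr rfl fun i _ => by rw [(hA.pow i).apply x y]

/-- Symmetry of hitting times for walk-regular networks. -/
lemma exists_green {A : Matrix V V ℝ} (hA : A.IsSymm)
    (hwr : ∀ (k : ℕ) (x y : V), (A ^ k) x x = (A ^ k) y y) (hc : ConnNet A) (d : ℝ)
    (hd : ∀ x, condAt A x = d) :
    ∃ Z : V → V → ℝ, (∀ x y, Z x y = Z y x) ∧ (∀ x y, Z x x = Z y y) ∧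
      ∀ b, ∃ s : ℝ, lapl A (fun x => Z x b) = Pi.single b 1 - fun _ => s := by
  set L : Matrix V V ℝ := Polynomial.aeval A (Polynomial.C d - Polynomial.X) with hL
  have hLd : L = d • (1 : Matrix V V ℝ) - A := by
    simp [hL, Algebra.algebraMap_eq_smul_one]
  have hLf : ∀ f, L.mulVec f = lapl A f := by
    intro f
    funext x
    have e : lapl A f x = ∑ y, A x y * (f x - f y) := rfl
    have hd' : ∑ y, A x y = d := hd x
    refine Eq.trans ?_ e.symm
    rw [hLd, Matrix.sub_mulVec, Matrix.smul_mulVec, Matrix.one_mulVec]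
    simp only [Pi.sub_apply, Pi.smul_apply, smul_eq_mul, ← hd', Matrix.mulVec, dotProduct,
      Finset.sum_mul, ← Finset.sum_sub_distrib]
    exact Finset.sum_congr rfl fun y _ => by ring
  have hcol : ∀ (M : Matrix V V ℝ) (b : V), (fun x => (L * M) x b) = lapl A (fun x => M x b) := by
    intro M b
    rw [← hLf]; rfl
  -- annihilating polynomial
  obtain ⟨p, hp0, hp⟩ : ∃ p : Polynomial ℝ, p ≠ 0 ∧ Polynomial.aeval L p = 0 :=
    ⟨L.charpoly, L.charpoly_monic.ne_zero, Matrix.aeval_self_charpoly L⟩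
  obtain ⟨g, hg, hndvd⟩ := Polynomial.exists_eq_pow_rootMultiplicity_mul_and_not_dvd p hp0 0
  rw [Polynomial.C_0, sub_zero] at hg hndvd
  have hg0 : g.coeff 0 ≠ 0 := fun h => hndvd (Polynomial.X_dvd_iff.2 h)
  set k := Polynomial.rootMultiplicity 0 p
  have hk : L ^ k * Polynomial.aeval L g = 0 := by
    rw [hg] at hp
    simpa using hp
  have hred : ∀ f, lapl A (lapl A f) = 0 → lapl A f = 0 := by
    intro f hf
    have hconst := hc.ker _ hf
    funext x
    have h1 := lapl_sum A hc.1 f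
    rw [Finset.sum_congr rfl (fun y _ => hconst y x)] at h1
    have : Nonempty V := ⟨x⟩
    simpa using h1
  have hredM : ∀ M : Matrix V V ℝ, L * (L * M) = 0 → L * M = 0 := by
    intro M h
    ext x b
    have h1 := hred (fun x => M x b) (by
      rw [← hcol, ← hcol (L * M), h]; rfl)
    rw [← hcol] at h1
    exact congrFun h1 x
  have hpow : ∀ (k : ℕ) (M : Matrix V V ℝ), L ^ k * M = 0 → L * M = 0 := by
    intro k
    induction k with
    | zero => intro M h; rw [pow_zero, one_mul] at h; rw [h, mul_zero]
    | succ k ih =>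
      intro M h
      rw [pow_succ, mul_assoc] at h
      exact hredM M (ih _ h)
  have hLM := hpow k _ hk
  have hcomp : ∀ q : Polynomial ℝ, Polynomial.aeval L q
      = Polynomial.aeval A (q.comp (Polynomial.C d - Polynomial.X)) := by
    intro q
    rw [Polynomial.aeval_comp]
  have hsymm : ∀ (q : Polynomial ℝ) (x y : V),
      (Polynomial.aeval L q) x y = (Polynomial.aeval L q) y x := by
    intro q x y
    rw [hcomp]; exact aeval_symm hA _ x y
  have hMc : ∀ b x y, (Polynomial.aeval L g) x b = (Polynomial.aeval L g) y b := by
    intro b x y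
    refine hc.ker (fun x => (Polynomial.aeval L g) x b) ?_ x y
    rw [← hcol, hLM]; rfl
  have hsplit : L * Polynomial.aeval L g.divX
      = Polynomial.aeval L g - g.coeff 0 • (1 : Matrix V V ℝ) := by
    have h := congrArg (Polynomial.aeval L) (Polynomial.X_mul_divX_add g)
    rw [map_add, map_mul, Polynomial.aeval_X, Polynomial.aeval_C,
      Algebra.algebraMap_eq_smul_one] at h
    exact eq_sub_of_add_eq h
  refine ⟨fun x y => -(1 / g.coeff 0) * (Polynomial.aeval L g.divX) x y, ?_, ?_, ?_⟩
  · intro x y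
    simp only [hsymm g.divX x y]
  · intro x y
    simp only [hcomp]
    rw [walkReg_const_diag hwr _ x y]
  · intro b
    refine ⟨(Polynomial.aeval L g) b b / g.coeff 0, ?_⟩
    have h1 : (fun x => -(1 / g.coeff 0) * (Polynomial.aeval L g.divX) x b)
        = (-(1 / g.coeff 0)) • (fun x => (Polynomial.aeval L g.divX) x b) := rfl
    rw [h1, map_smul, ← hcol, hsplit]
    funext x
    simp only [Pi.smul_apply, smul_eq_mul, Matrix.sub_apply, Matrix.smul_apply, Pi.sub_apply,
      Matrix.one_apply, Pi.single_apply, hMc b x b]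
    split_ifs <;> field_simp <;> ring

lemma hitTime_symm {A : Matrix V V ℝ} (hA : A.IsSymm)
    (hwr : ∀ (k : ℕ) (x y : V), (A ^ k) x x = (A ^ k) y y) (hc : ConnNet A)
    (hV : 3 ≤ Fintype.card V) (d : ℝ)
    (hd : ∀ x, condAt A x = d) (a b : V) :
    hitTime (step A) a b = hitTime (step A) b a := by
  obtain ⟨Z, hZs, hZd, hZ⟩ := exists_green hA hwr hc d hd
  have hn : (Fintype.card V : ℝ) ≠ 0 := by
    have : Fintype.card V ≠ 0 := by omega
    exact_mod_cast this
  have key : ∀ a b, hitTime (step A) a b = Fintype.card V * d * (Z b b - Z a b) := by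
    intro a b
    obtain ⟨s, hs⟩ := hZ b
    have hs1 : 1 - Fintype.card V * s = 0 := by
      have := lapl_sum A hc.1 (fun x => Z x b)
      rw [hs] at this
      simpa [Finset.sum_sub_distrib] using this
    have h1 := hc.ker ((fun x => hitTime (step A) x b)
        + (Fintype.card V * d) • (fun x => Z x b)) (by
      rw [map_add, map_smul, lapl_hitTime hc hV, hs]
      funext x
      simp only [Pi.add_apply, Pi.smul_apply, Pi.sub_apply, Pi.single_apply, smul_eq_mul, hd,
        Finset.sum_const, Finset.card_univ, nsmul_eq_mul, Pi.zero_apply]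
      split_ifs
      · linear_combination d * hs1
      · linear_combination d * hs1) a b
    simp only [Pi.add_apply, Pi.smul_apply, smul_eq_mul, hitTime_self] at h1
    linarith
  rw [key a b, key b a, hZs a b, hZd a b]

lemma condAt_gw (G : SimpleGraph V) [DecidableRel G.Adj] (x : V) :
    condAt (gw G) x = G.degree x := by
  have h : ∀ y, gw G x y = if G.Adj x y then 1 else 0 := by
    intro y
    unfold gw
    split_ifs <;> rfl
  simp only [condAt, h]
  rw [Finset.sum_boole, ← SimpleGraph.card_neighborFinset_eq_degree,
    SimpleGraph.neighborFinset_eq_filter]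

lemma gw_delete (G : SimpleGraph V) {a b : V} (hab : G.Adj a b) (x y : V) :
    gw (G.deleteEdges {s(a, b)}) x y = gw G x y
      - (if x = a then (if y = b then 1 else 0) else 0)
      - (if x = b then (if y = a then 1 else 0) else 0) := by
  classical
  have hne := hab.ne
  have hba := hab.symm
  unfold gw
  simp only [SimpleGraph.deleteEdges_adj, Set.mem_singleton_iff, Sym2.eq_iff]
  by_cases h1 : x = a <;> by_cases h2 : y = b <;> by_cases h3 : x = b <;> by_cases h4 : y = a <;>
    by_cases h5 : G.Adj x y <;> simp_all

end Helpers

/-- Deleting a non-cut-edge `ab` from a walk-regular graph increases the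
hitting time from `E_a T_b = |E| R_{ab}` to
`(|E| - 1) R_{ab} / (1 - R_{ab}) = (E_a T_b - R_{ab}) / (1 - R_{ab})`. -/
theorem walk_regular_delete_edge {V : Type*} [Fintype V] [DecidableEq V]
    (G : SimpleGraph V) [DecidableRel G.Adj] (hconn : G.Connected)
    (hcard : 3 ≤ Fintype.card V)
    (hwr : ∀ (k : ℕ) (x y : V),
      ((G.adjMatrix ℝ) ^ k) x x = ((G.adjMatrix ℝ) ^ k) y y)
    (a b : V) (hab : G.Adj a b)
    (hcut : (G.deleteEdges {s(a, b)}).Connected) :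
    hitTime (step (gw (G.deleteEdges {s(a, b)}))) a b
        = ((numEdges G : ℝ) - 1) * effRes (gw G) a b / (1 - effRes (gw G) a b) ∧
      hitTime (step (gw (G.deleteEdges {s(a, b)}))) a b
        = (hitTime (step (gw G)) a b - effRes (gw G) a b)
            / (1 - effRes (gw G) a b) := by
  have hc := connNet_gw G hconn
  have hc' := connNet_gw _ hcut
  have hne := hab.ne
  have hgA : (G.adjMatrix ℝ : Matrix V V ℝ) = gw G := by
    funext x y
    simp [SimpleGraph.adjMatrix_apply, gw]
  have hdeg : ∀ x, condAt (gw G) x = G.degree a := by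
    intro x
    have h := hwr 2 x a
    rw [sq, SimpleGraph.adjMatrix_mul_self_apply_self,
      SimpleGraph.adjMatrix_mul_self_apply_self] at h
    rw [condAt_gw, h]
  have hsym : hitTime (step (gw G)) a b = hitTime (step (gw G)) b a := by
    have h := hitTime_symm (A := G.adjMatrix ℝ) (SimpleGraph.isSymm_adjMatrix G) hwr
      (by rw [hgA]; exact hc) hcard (G.degree a) (by rw [hgA]; exact hdeg) a b
    rw [hgA] at h
    exact h
  have hm : ∑ x, condAt (gw G) x = 2 * (numEdges G : ℝ) := by
    have h := G.sum_degrees_eq_twice_card_edges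
    have h2 : numEdges G = G.edgeFinset.card := by
      unfold numEdges
      rw [Set.ncard_eq_toFinset_card']; rfl
    rw [h2]
    simp only [condAt_gw]
    exact_mod_cast h
  have hm1 : (numEdges G : ℝ) - 1 ≠ 0 := by
    have hd1 : 1 ≤ G.degree a := (G.degree_pos_iff_exists_adj a).2 ⟨b, hab⟩
    have h := hm
    simp only [hdeg, Finset.sum_const, Finset.card_univ, nsmul_eq_mul] at h
    have h3 : (3 : ℝ) ≤ Fintype.card V := by exact_mod_cast hcard
    have h4 : (1 : ℝ) ≤ G.degree a := by exact_mod_cast hd1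
    intro h5
    nlinarith
  obtain ⟨v, hv, hvb⟩ := hc.solve b (Pi.single a 1 - Pi.single b 1) (by
    simp [Finset.sum_sub_distrib])
  have hR := effRes_eq hc hne v hv
  rw [hvb, sub_zero] at hR
  rw [hR]
  have hmul : hitTime (step (gw G)) a b = numEdges G * v a := by
    have h1 := hc.ker ((fun x => hitTime (step (gw G)) x b) - (fun x => hitTime (step (gw G)) x a)
        - (2 * (numEdges G : ℝ)) • v) (by
      rw [map_sub, map_sub, map_smul, lapl_hitTime hc hcard, lapl_hitTime hc hcard, hv, hm]
      funext x
      simp only [Pi.smul_apply, Pi.sub_apply, Pi.single_apply, smul_eq_mul, Pi.zero_apply]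
      split_ifs <;> ring) a b
    simp only [Pi.sub_apply, Pi.smul_apply, smul_eq_mul, hitTime_self, hvb] at h1
    linarith
  have hcond' : ∀ x, condAt (gw (G.deleteEdges {s(a, b)})) x = condAt (gw G) x
      - (if x = a then 1 else 0) - (if x = b then 1 else 0) := by
    intro x
    unfold condAt
    simp only [gw_delete G hab, Finset.sum_sub_distrib]
    congr 1
    · congr 1
      split_ifs <;> simp
    · split_ifs <;> simp
  have hlap' : ∀ f x, lapl (gw (G.deleteEdges {s(a, b)})) f x = lapl (gw G) f x
      - (if x = a then f a - f b else 0) - (if x = b then f b - f a else 0) := by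
    intro f x
    simp only [lapl_apply, gw_delete G hab, sub_mul, Finset.sum_sub_distrib]
    congr 1
    · congr 1
      split_ifs with h <;> simp [h]
    · split_ifs with h <;> simp [h]
  set t := hitTime (step (gw (G.deleteEdges {s(a, b)}))) a b with ht
  have hmain : t = numEdges G * v a + (t - 1) * v a := by
    have h1 := hc.ker ((fun x => hitTime (step (gw (G.deleteEdges {s(a, b)}))) x b)
        - (fun x => hitTime (step (gw G)) x b) - (t - 1) • v) (by
      rw [map_sub, map_sub, map_smul, lapl_hitTime hc hcard, hv, hm]
      funext x
      have h2 := congrFun (lapl_hitTime hc' hcard b) x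
      rw [hlap'] at h2
      have h3 : ∑ z, condAt (gw (G.deleteEdges {s(a, b)})) z = 2 * (numEdges G : ℝ) - 2 := by
        simp only [hcond', Finset.sum_sub_distrib, hm]
        simp
        ring
      rw [h3, hcond'] at h2
      simp only [hitTime_self, ← ht] at h2
      simp only [Pi.smul_apply, Pi.sub_apply, Pi.single_apply, smul_eq_mul, Pi.zero_apply]
      by_cases hxa : x = a
      · have hxb : x ≠ b := by rw [hxa]; exact hne
        simp only [if_pos hxa, if_neg hxb] at h2 ⊢
        linarith
      · by_cases hxb : x = b
        · simp only [if_neg hxa, if_pos hxb] at h2 ⊢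
          linarith
        · simp only [if_neg hxa, if_neg hxb] at h2 ⊢
          linarith) a b
    simp only [Pi.sub_apply, Pi.smul_apply, smul_eq_mul, hitTime_self, hvb, hmul, ← ht] at h1
    linarith
  have hR1 : 1 - v a ≠ 0 := by
    intro h
    have h1 : v a = 1 := by linarith
    rw [h1] at hmain
    exact hm1 (by linarith)
  constructor
  · rw [eq_div_iff hR1]; linarith
  · rw [eq_div_iff hR1, hmul]; linarith
end

section
/- Let G be a finite connected regular edge-transitive graph and ab an edge that is not a cut-edge. Then after deleting the edge ab, the expected hitting time from a to b for simple random walk on G' = G minus ab equals (|E|-1)(|V|-1)/(|E| - |V| + 1). -/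
open Finset

section Helpers

variable {V : Type*} [Fintype V]

/-- Graph Laplacian acting on functions. -/
noncomputable def lapF (H : SimpleGraph V) (f : V → ℝ) (x : V) : ℝ :=
  ∑ y, gw H x y * (f x - f y)

lemma gw_symm (H : SimpleGraph V) (x y : V) : gw H x y = gw H y x := by
  have := H.adj_comm x y
  unfold gw; split_ifs <;> tauto

lemma gw_nonneg (H : SimpleGraph V) (x y : V) : 0 ≤ gw H x y := by
  unfold gw; split_ifs <;> norm_num

lemma lapF_eq [DecidableEq V] (H : SimpleGraph V) [DecidableRel H.Adj] (f : V → ℝ) :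
    (H.lapMatrix ℝ).mulVec f = lapF H f := by
  ext x
  rw [SimpleGraph.lapMatrix_mulVec_apply, SimpleGraph.degree_eq_sum_if_adj, Finset.sum_mul,
    SimpleGraph.neighborFinset_eq_filter, Finset.sum_filter, ← Finset.sum_sub_distrib]
  unfold lapF gw
  refine Finset.sum_congr rfl fun y _ => ?_
  split_ifs <;> simp

lemma lapF_zero_const (H : SimpleGraph V) (hc : H.Connected) (f : V → ℝ)
    (h : ∀ x, lapF H f x = 0) (x y : V) : f x = f y := by
  classical
  have h1 : (H.lapMatrix ℝ).mulVec f = 0 := by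
    rw [lapF_eq]; ext x; exact h x
  exact (SimpleGraph.lapMatrix_mulVec_eq_zero_iff_forall_reachable H).1 h1 x y (hc x y)

lemma lapF_selfadj (H : SimpleGraph V) (f g : V → ℝ) :
    ∑ x, f x * lapF H g x = ∑ x, g x * lapF H f x := by
  have key : ∀ f g : V → ℝ, ∑ x, f x * lapF H g x
      = ∑ x, ∑ y, gw H x y * (f x * g x) - ∑ x, ∑ y, gw H x y * (f x * g y) := by
    intro f g
    rw [← Finset.sum_sub_distrib]
    refine Finset.sum_congr rfl fun x _ => ?_
    rw [← Finset.sum_sub_distrib, lapF, Finset.mul_sum]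
    exact Finset.sum_congr rfl fun y _ => by ring
  rw [key, key]
  congr 1
  · exact Finset.sum_congr rfl fun x _ => Finset.sum_congr rfl fun y _ => by ring
  · rw [Finset.sum_comm]
    exact Finset.sum_congr rfl fun x _ => Finset.sum_congr rfl fun y _ => by
      rw [gw_symm]; ring

lemma lapF_sum (H : SimpleGraph V) (f : V → ℝ) : ∑ x, lapF H f x = 0 := by
  have := lapF_selfadj H (fun _ => 1) f
  simpa [lapF] using this

open scoped Classical in
/-- Existence of the Green function. -/
lemma exists_green_s13 (H : SimpleGraph V) (hc : H.Connected) :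
    ∃ K : V → V → ℝ, (∀ x y, K x y = K y x) ∧
      (∀ (φ : H ≃g H) x y, K (φ x) (φ y) = K x y) ∧
      (∀ y, ∑ x, K x y = 1 / (Fintype.card V : ℝ)) ∧
      (∀ y x, lapF H (fun z => K z y) x
        = (if x = y then 1 else 0) - 1 / (Fintype.card V : ℝ)) := by
  have := hc.nonempty
  have hn : (Fintype.card V : ℝ) ≠ 0 := by exact_mod_cast Fintype.card_ne_zero
  set J : Matrix V V ℝ := Matrix.of fun _ _ => 1 with hJ
  set M : Matrix V V ℝ := H.lapMatrix ℝ + J with hM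
  have hMv : ∀ v x, (M.mulVec v) x = lapF H v x + ∑ y, v y := by
    intro v x
    rw [hM, Matrix.add_mulVec, lapF_eq]
    simp [hJ, Matrix.mulVec, dotProduct]
  have hsum : ∀ v, ∑ x, (M.mulVec v) x = Fintype.card V * ∑ y, v y := by
    intro v
    simp_rw [hMv]
    rw [Finset.sum_add_distrib, lapF_sum]; simp
  have hdet : M.det ≠ 0 := by
    intro h0
    obtain ⟨v, hv, hMv0⟩ := Matrix.exists_mulVec_eq_zero_iff.2 h0
    have hs := hsum v
    rw [hMv0] at hs
    have hs0 : ∑ y, v y = 0 := by simpa [hn] using hs.symm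
    have hl : ∀ x, lapF H v x = 0 := by
      intro x
      have := hMv v x
      rw [hMv0, hs0] at this; simpa using this.symm
    have hconst := lapF_zero_const H hc v hl
    apply hv
    ext x
    have : ∑ y, v y = Fintype.card V * v x := by
      rw [Finset.sum_congr rfl fun y _ => hconst y x]; simp
    rw [hs0] at this
    simpa [hn] using this.symm
  have hu : IsUnit M.det := isUnit_iff_ne_zero.2 hdet
  have hMs : M.transpose = M := by
    rw [hM, Matrix.transpose_add, SimpleGraph.isSymm_lapMatrix]
    congr 1
  have hcol : ∀ y, M.mulVec (fun z => M⁻¹ z y) = fun x => if x = y then 1 else 0 := by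
    intro y
    ext x
    have := congrFun (congrFun (Matrix.mul_nonsing_inv M hu) x) y
    rw [Matrix.mul_apply, Matrix.one_apply] at this
    simpa [Matrix.mulVec, dotProduct] using this
  have hcs : ∀ y, ∑ x, M⁻¹ x y = 1 / (Fintype.card V : ℝ) := by
    intro y
    have := hsum (fun z => M⁻¹ z y)
    rw [hcol] at this
    simp at this
    field_simp
    linarith
  refine ⟨fun x y => M⁻¹ x y, ?_, ?_, hcs, ?_⟩
  · intro x y
    have : (M⁻¹).transpose = M⁻¹ := by rw [Matrix.transpose_nonsing_inv, hMs]
    exact (congrFun (congrFun this y) x)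
  · intro φ x y
    have h1 : M.submatrix φ.toEquiv φ.toEquiv = M := by
      ext x y
      simp only [hM, hJ, Matrix.submatrix_apply, Matrix.add_apply, SimpleGraph.lapMatrix,
        SimpleGraph.degMatrix, Matrix.sub_apply, Matrix.diagonal_apply,
        SimpleGraph.adjMatrix_apply]
      have e1 : H.degree (φ x) = H.degree x := SimpleGraph.Iso.degree_eq φ x
      have e2 : H.Adj (φ x) (φ y) ↔ H.Adj x y := φ.map_adj_iff
      simp
      split_ifs <;> tauto
    have h2 := Matrix.inv_submatrix_equiv M φ.toEquiv φ.toEquiv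
    rw [h1] at h2
    exact (congrFun (congrFun h2 x) y).symm
  · intro y x
    have := hMv (fun z => M⁻¹ z y) x
    rw [hcol, hcs] at this
    simp only at this ⊢
    linarith

lemma exists_solve (H : SimpleGraph V) (hc : H.Connected) (f : V → ℝ) (hf : ∑ x, f x = 0) :
    ∃ u : V → ℝ, ∀ x, lapF H u x = f x := by
  classical
  obtain ⟨K, -, -, -, hK⟩ := exists_green_s13 H hc
  refine ⟨fun z => ∑ y, K z y * f y, fun x => ?_⟩
  have : lapF H (fun z => ∑ y, K z y * f y) x = ∑ y, lapF H (fun z => K z y) x * f y := by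
    unfold lapF
    simp_rw [Finset.sum_mul]
    rw [Finset.sum_comm]
    refine Finset.sum_congr rfl fun w _ => ?_
    rw [← Finset.sum_sub_distrib, Finset.mul_sum]
    exact Finset.sum_congr rfl fun y _ => by ring
  rw [this]
  simp_rw [hK, sub_mul, Finset.sum_sub_distrib, ← Finset.mul_sum, hf]
  simp

lemma condAt_pos [Nontrivial V] (H : SimpleGraph V) (hc : H.Connected) (x : V) :
    0 < condAt (gw H) x := by
  classical
  have h := hc.preconnected.degree_pos_of_nontrivial x
  have : condAt (gw H) x = H.degree x := by
    rw [SimpleGraph.degree_eq_sum_if_adj]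
    simp [condAt, gw]
  rw [this]; exact_mod_cast h

lemma lapF_step [Nontrivial V] (H : SimpleGraph V) (hc : H.Connected) (f : V → ℝ) (x : V) :
    lapF H f x = condAt (gw H) x * (f x - ∑ y, step (gw H) x y * f y) := by
  have h := (condAt_pos H hc x).ne'
  rw [mul_sub, Finset.mul_sum]
  simp only [lapF, mul_sub, Finset.sum_sub_distrib, ← Finset.sum_mul]
  congr 1
  refine Finset.sum_congr rfl fun y _ => ?_
  unfold step; field_simp

lemma hitTime_spec [Nontrivial V] (H : SimpleGraph V) (hc : H.Connected) (b : V) :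
    hitTime (step (gw H)) b b = 0 ∧
    ∀ x, x ≠ b → lapF H (fun z => hitTime (step (gw H)) z b) x = condAt (gw H) x := by
  classical
  set P := step (gw H) with hP
  have hP0 : ∀ x y, 0 ≤ P x y := fun x y =>
    div_nonneg (gw_nonneg H x y) (condAt_pos H hc x).le
  have hP1 : ∀ x, ∑ y, P x y = 1 := fun x => by
    simp only [hP, step]
    rw [← Finset.sum_div]
    exact div_self (condAt_pos H hc x).ne'
  have hsb : ∀ n, surv P b n b = 0 := by
    intro n; cases n <;> simp [surv]
  have hss : ∀ n x, x ≠ b → surv P b (n+1) x = ∑ y, P x y * surv P b n y := by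
    intro n x hx; simp [surv, hx]
  have hs0 : ∀ x, x ≠ b → surv P b 0 x = 1 := by
    intro x hx; simp [surv, hx]
  have hnn : ∀ n x, 0 ≤ surv P b n x := by
    intro n
    induction n with
    | zero => intro x; simp only [surv]; split_ifs <;> norm_num
    | succ n ih =>
      intro x
      by_cases hx : x = b
      · rw [hx, hsb]
      · rw [hss n x hx]
        exact Finset.sum_nonneg fun y _ => mul_nonneg (hP0 x y) (ih y)
  -- a supersolution
  obtain ⟨u0, hu0⟩ := exists_solve H hc
    (fun x => condAt (gw H) x - (if x = b then ∑ z, condAt (gw H) z else 0)) (by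
      rw [Finset.sum_sub_distrib]; simp)
  obtain ⟨u, hub, hu⟩ : ∃ u : V → ℝ, u b = 0 ∧ ∀ x, x ≠ b → u x = 1 + ∑ y, P x y * u y := by
    refine ⟨fun x => u0 x - u0 b, by simp, fun x hx => ?_⟩
    have h1 := hu0 x
    rw [lapF_step H hc, if_neg hx, sub_zero] at h1
    have h2 : u0 x - ∑ y, P x y * u0 y = 1 :=
      mul_left_cancel₀ (condAt_pos H hc x).ne' (by rw [h1, mul_one])
    simp only [mul_sub, Finset.sum_sub_distrib, ← Finset.sum_mul, hP1]
    linarith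
  have hunn : ∀ x, 0 ≤ u x := by
    obtain ⟨m, hm⟩ := Finite.exists_min u
    by_cases hmb : m = b
    · intro x; have := hm x; rw [hmb, hub] at this; exact this
    · exfalso
      have h1 := hu m hmb
      have h2 : ∑ y, P m y * u m ≤ ∑ y, P m y * u y :=
        Finset.sum_le_sum fun y _ => mul_le_mul_of_nonneg_left (hm y) (hP0 m y)
      rw [← Finset.sum_mul, hP1] at h2
      linarith
  have hpart : ∀ N x, ∑ n ∈ Finset.range N, surv P b n x ≤ u x := by
    intro N
    induction N with
    | zero => intro x; simpa using hunn x
    | succ N ih =>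
      intro x
      by_cases hx : x = b
      · rw [hx, hub]; simp [hsb]
      · rw [Finset.sum_range_succ', hs0 x hx, hu x hx]
        simp_rw [hss _ x hx]
        rw [Finset.sum_comm]
        simp_rw [← Finset.mul_sum]
        have : ∑ y, P x y * ∑ n ∈ Finset.range N, surv P b n y ≤ ∑ y, P x y * u y :=
          Finset.sum_le_sum fun y _ => mul_le_mul_of_nonneg_left (ih y) (hP0 x y)
        linarith
  have hsm : ∀ x, Summable fun n => surv P b n x := fun x =>
    summable_of_sum_range_le (fun n => hnn n x) (fun N => hpart N x)
  refine ⟨by simp [hitTime, hsb], fun x hx => ?_⟩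
  rw [lapF_step H hc]
  have : hitTime P x b = 1 + ∑ y, P x y * hitTime P y b := by
    unfold hitTime
    rw [(hsm x).tsum_eq_zero_add, hs0 x hx]
    congr 1
    simp_rw [hss _ x hx]
    rw [Summable.tsum_finsetSum fun y _ => (hsm y).mul_left _]
    exact Finset.sum_congr rfl fun y _ => tsum_mul_left
  rw [← hP, this]; ring

end Helpers

/-- For a regular edge-transitive graph, deleting the non-cut-edge `ab` makes
the hitting time from `a` to `b` equal to `(|E|-1)(|V|-1)/(|E|-|V|+1)`. -/
theorem edge_transitive_delete_edge {V : Type*} [Fintype V]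
    (G : SimpleGraph V) [DecidableRel G.Adj] (hconn : G.Connected)
    (d : ℕ) (hreg : G.IsRegularOfDegree d)
    (htrans : ∀ e₁ ∈ G.edgeSet, ∀ e₂ ∈ G.edgeSet,
      ∃ φ : G ≃g G, Sym2.map φ e₁ = e₂)
    (a b : V) (hab : G.Adj a b)
    (hcut : (G.deleteEdges {s(a, b)}).Connected) :
    hitTime (step (gw (G.deleteEdges {s(a, b)}))) a b
      = ((numEdges G : ℝ) - 1) * ((Fintype.card V : ℝ) - 1)
          / ((numEdges G : ℝ) - (Fintype.card V : ℝ) + 1) := by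
  classical
  have hne : a ≠ b := hab.ne
  have : Nontrivial V := ⟨a, b, hne⟩
  have hn : (Fintype.card V : ℝ) ≠ 0 := by exact_mod_cast Fintype.card_ne_zero
  set n : ℝ := (Fintype.card V : ℝ) with hndef
  set m : ℝ := (numEdges G : ℝ) with hmdef
  set G' := G.deleteEdges {s(a, b)} with hG'
  obtain ⟨K, Ksymm, Kinv, Ksum, Klap⟩ := exists_green_s13 G hconn
  -- degrees
  have hdeg : ∀ x, ∑ y, gw G x y = d := by
    intro x
    rw [← hreg x, SimpleGraph.degree_eq_sum_if_adj]
    refine Finset.sum_congr rfl fun y _ => ?_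
    unfold gw
    split_ifs <;> rfl
  have hnd : n * d = 2 * m := by
    have h1 := G.sum_degrees_eq_twice_card_edges
    simp only [hreg.degree_eq, Finset.sum_const, Finset.card_univ, smul_eq_mul] at h1
    have h2 : numEdges G = G.edgeFinset.card := by
      rw [numEdges, ← SimpleGraph.coe_edgeFinset, Set.ncard_coe_finset]
    rw [hndef, hmdef, h2]
    exact_mod_cast h1
  -- constant resistance across edges
  set R : ℝ := K a a + K b b - 2 * K a b with hR
  have hRc : ∀ x y, G.Adj x y → K x x + K y y - 2 * K x y = R := by
    intro x y hxy
    obtain ⟨φ, hφ⟩ := htrans s(a, b) hab s(x, y) hxy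
    rw [Sym2.map_mk, Sym2.eq_iff] at hφ
    rcases hφ with ⟨h1, h2⟩ | ⟨h1, h2⟩
    · rw [← h1, ← h2, Kinv, Kinv, Kinv]
    · rw [← h1, ← h2, Kinv, Kinv, Kinv, Ksymm b a, hR]; ring
  have hlapδ : ∀ x, lapF G (fun z => K z z) x = 2 * (1 - 1 / n) - d * R := by
    intro x
    have h1 := Klap x x
    rw [if_pos rfl] at h1
    rw [← h1, ← hdeg x, Finset.sum_mul, lapF, lapF, Finset.mul_sum, ← Finset.sum_sub_distrib]
    refine Finset.sum_congr rfl fun y _ => ?_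
    by_cases hxy : G.Adj x y
    · have := hRc x y hxy
      rw [← this, Ksymm y x]; ring
    · simp [gw, hxy]
  have hdR : 2 * (1 - 1 / n) - d * R = 0 := by
    have h1 := lapF_sum G (fun z => K z z)
    simp_rw [hlapδ] at h1
    rw [Finset.sum_const, Finset.card_univ, nsmul_eq_mul] at h1
    exact (mul_eq_zero.1 h1).resolve_left hn
  have hδ : K a a = K b b :=
    lapF_zero_const G hconn (fun z => K z z) (fun x => by rw [hlapδ, hdR]) a b
  have hmR : m * R = n - 1 := by
    have : n * (2 * (1 - 1 / n) - d * R) = 0 := by rw [hdR, mul_zero]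
    have h2 : n * (1 / n) = 1 := by field_simp
    linear_combination (-1/2) * this - h2 - (1/2) * R * hnd
  -- the deleted graph
  have hgw : ∀ x y, gw G' x y = gw G x y - (if x = a then 1 else 0) * (if y = b then 1 else 0)
      - (if x = b then 1 else 0) * (if y = a then 1 else 0) := by
    intro x y
    have hba := hab.symm
    have hadj : G'.Adj x y ↔ G.Adj x y ∧ ¬ ((x = a ∧ y = b) ∨ (x = b ∧ y = a)) := by
      rw [hG', SimpleGraph.deleteEdges_adj]; simp
    unfold gw
    by_cases h1 : x = a
    · subst h1
      by_cases h2 : y = b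
      · subst h2; simp [hadj, hab, hne]
      · simp [hadj, h2, hne]
    · by_cases h2 : x = b
      · subst h2
        by_cases h3 : y = a
        · subst h3; simp [hadj, hba, h1]
        · simp [hadj, h1, h3]
      · simp [hadj, h1, h2]
  have hcond : ∀ x, condAt (gw G') x
      = d - (if x = a then 1 else 0) - (if x = b then 1 else 0) := by
    intro x
    rw [condAt]
    simp_rw [hgw]
    rw [Finset.sum_sub_distrib, Finset.sum_sub_distrib, hdeg, ← Finset.mul_sum, ← Finset.mul_sum]
    simp
  have hlap' : ∀ f x, lapF G' f x = lapF G f x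
      - (f a - f b) * ((if x = a then 1 else 0) - (if x = b then 1 else 0)) := by
    intro f x
    unfold lapF
    simp_rw [hgw, sub_mul, Finset.sum_sub_distrib, mul_assoc, ← Finset.mul_sum]
    simp only [ite_mul, one_mul, zero_mul, Finset.sum_ite_eq', Finset.mem_univ, if_true]
    split_ifs with h1 h2 h2
    · exact absurd (h1.symm.trans h2) hne
    · rw [h1]; ring
    · rw [h2]; ring
    · ring
  -- the potential
  set g : V → ℝ := fun x => K x a - K x b with hg
  have hgR : g a - g b = R := by simp only [hg, hR, Ksymm b a]; ring
  have hg0 : g a + g b = 0 := by simp only [hg, Ksymm b a, hδ]; ring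
  have hgsum : ∑ x, g x = 0 := by
    simp only [hg, Finset.sum_sub_distrib, Ksum, sub_self]
  have hglap : ∀ x, lapF G g x = (if x = a then 1 else 0) - (if x = b then 1 else 0) := by
    intro x
    have h1 : lapF G g x = lapF G (fun z => K z a) x - lapF G (fun z => K z b) x := by
      unfold lapF
      rw [← Finset.sum_sub_distrib]
      exact Finset.sum_congr rfl fun y _ => by simp only [hg]; ring
    rw [h1, Klap, Klap]; ring
  have hglap' : ∀ x, lapF G' g x
      = (1 - R) * ((if x = a then 1 else 0) - (if x = b then 1 else 0)) := by
    intro x; rw [hlap', hglap, hgR]; ring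
  have hR1 : 1 - R ≠ 0 := by
    intro h0
    have h1 := lapF_zero_const G' hcut g (fun x => by rw [hglap', h0, zero_mul]) a b
    have h2 : R = 0 := by rw [← hgR, h1, sub_self]
    rw [h2] at h0; norm_num at h0
  -- hitting time
  obtain ⟨hbb, hh⟩ := hitTime_spec G' hcut b
  set h : V → ℝ := fun z => hitTime (step (gw G')) z b with hhdef
  have hsumdeg : ∑ x, condAt (gw G') x = 2 * m - 2 := by
    simp_rw [hcond]
    rw [Finset.sum_sub_distrib, Finset.sum_sub_distrib]
    simp
    linarith
  have hlaph : ∀ x, lapF G' h x = condAt (gw G') x - (if x = b then 2 * m - 2 else 0) := by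
    intro x
    by_cases hx : x = b
    · subst hx
      rw [if_pos rfl]
      have h1 := lapF_sum G' h
      have h2 : ∑ z, (lapF G' h z - condAt (gw G') z) = lapF G' h x - condAt (gw G') x :=
        Finset.sum_eq_single x (fun z _ hz => by rw [hh z hz, sub_self]) (by simp)
      rw [Finset.sum_sub_distrib, h1, hsumdeg] at h2
      linarith
    · rw [if_neg hx, sub_zero, hh x hx]
  have hadj := lapF_selfadj G' h g
  have hL : ∑ x, h x * lapF G' g x = (1 - R) * h a := by
    have h1 : ∀ x, h x * lapF G' g x
        = (1 - R) * (h x * (if x = a then 1 else 0) - h x * (if x = b then 1 else 0)) := by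
      intro x; rw [hglap']; ring
    simp_rw [h1]
    rw [← Finset.mul_sum, Finset.sum_sub_distrib]
    have h2 : h b = 0 := hbb
    simp [h2]
  have hRt : ∑ x, g x * lapF G' h x = R * (m - 1) := by
    have h1 : ∀ x, g x * lapF G' h x = d * g x - g x * (if x = a then 1 else 0)
        - g x * (if x = b then 1 else 0) - (2 * m - 2) * (g x * (if x = b then 1 else 0)) := by
      intro x; rw [hlaph, hcond]; split_ifs <;> ring
    simp_rw [h1]
    simp only [Finset.sum_sub_distrib, ← Finset.mul_sum, hgsum]
    simp
    linear_combination (m - 1) * hgR - m * hg0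
  rw [hL, hRt] at hadj
  change h a = _
  have hm0 : m ≠ 0 := by
    intro h0
    have hpos : 0 < G.degree a := (G.degree_pos_iff_exists_adj a).2 ⟨b, hab⟩
    rw [hreg a] at hpos
    have : (d : ℝ) ≠ 0 := by exact_mod_cast hpos.ne'
    rw [h0, mul_zero] at hnd
    exact (mul_ne_zero hn this) hnd
  have hden : m - n + 1 = m * (1 - R) := by linear_combination hmR
  rw [hden, ← hmR, eq_div_iff (mul_ne_zero hm0 hR1)]
  linear_combination m * hadj
end
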